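/- For every integer n ≥ 1, all integers j, k with 0 ≤ j, k ≤ n and j ≠ k, and every z ∈ ℂ, the Veronese sections are pointwise orthogonal: ⟨V̂ⱼⁿ(z), V̂ₖⁿ(z)⟩ = 0. -/

import Mathlib

open Complex Finset

/-- The `j`-th Veronese section `V̂ⱼⁿ : ℂ → ℂ^{n+1}`, whose `r`-th component is
`f_{j,r}(z) = (j!/(1+|z|²)^j)·√(binom n r)·Σ_{k=0}^{j} (−1)^k·binom r (j−k)·binom (n−r) k·z^{r−j+k}·conj(z)^k`. -/
noncomputable def veroneseSection (n j : ℕ) (z : ℂ) : Fin (n + 1) → ℂ :=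
  fun r =>
    ((j.factorial : ℂ) / (1 + (Complex.normSq z : ℂ)) ^ j) *
      (Real.sqrt (n.choose (r : ℕ)) : ℂ) *
      ∑ k ∈ Finset.range (j + 1),
        (-1 : ℂ) ^ k * ((r : ℕ).choose (j - k) : ℂ) * ((n - (r : ℕ)).choose k : ℂ) *
          z ^ ((r : ℕ) - (j - k)) * ((starRingEnd ℂ) z) ^ k

open Polynomial in
/-- The coefficients of `(1 + a t)^m`. -/
theorem coeff_one_add_C_mul_X_pow {R : Type*} [CommRing R] (a : R) (m k : ℕ) :
    ((1 + C a * X : R[X]) ^ m).coeff k = (m.choose k : R) * a ^ k := by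
  have h : (1 + C a * X : R[X]) ^ m = ((1 + X : R[X]) ^ m).comp (C a * X) := by simp
  rw [h, comp_C_mul_X_coeff, coeff_one_add_X_pow]

open Polynomial in
/-- The generating polynomial `(z + t)^r (1 - w t)^m` of the sums in the Veronese sections. -/
noncomputable def veroneseGen (z w : ℂ) (r m : ℕ) : ℂ[X] :=
  (1 + C (-w) * X) ^ m * (X + C z) ^ r

theorem coeff_veroneseGen (z w : ℂ) (r m j : ℕ) :
    (veroneseGen z w r m).coeff j = ∑ k ∈ Finset.range (j + 1),
      (-1 : ℂ) ^ k * (r.choose (j - k) : ℂ) * (m.choose k : ℂ) * z ^ (r - (j - k)) * w ^ k := by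
  rw [veroneseGen, Polynomial.coeff_mul, Finset.Nat.sum_antidiagonal_eq_sum_range_succ_mk]
  refine Finset.sum_congr rfl fun k _ => ?_
  rw [coeff_one_add_C_mul_X_pow, Polynomial.coeff_X_add_C_pow, neg_pow w]
  ring

open Polynomial in
theorem sum_choose_mul_veroneseGen (z w : ℂ) (n : ℕ) :
    ∑ r ∈ Finset.range (n + 1), (n.choose r : ℂ[X][X]) *
      (C (veroneseGen z w r (n - r)) * (veroneseGen w z r (n - r)).map C) =
    C (C ((1 + z * w) ^ n)) * (1 + C X * X) ^ n := by
  have h : (C (C ((1 + z * w) ^ n)) * (1 + C X * X) ^ n : ℂ[X][X]) =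
      ((C (X + C z) * (X + C (C w))) +
        (C (1 + C (-w) * X) * (1 + C (C (-z)) * X))) ^ n := by
    rw [C_pow, C_pow, ← mul_pow]
    congr 1
    simp only [map_add, map_mul, map_neg, map_one]
    ring
  rw [h, add_pow]
  refine Finset.sum_congr rfl fun r _ => ?_
  simp only [veroneseGen, Polynomial.map_mul, Polynomial.map_pow, Polynomial.map_add, map_X,
    map_C, Polynomial.map_one, C_mul, C_pow, mul_pow]
  ring

theorem sum_choose_mul_coeff_veroneseGen (z w : ℂ) (n : ℕ) {j k : ℕ} (hjk : j ≠ k) :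
    ∑ r ∈ Finset.range (n + 1), (n.choose r : ℂ) *
      ((veroneseGen z w r (n - r)).coeff j * (veroneseGen w z r (n - r)).coeff k) = 0 := by
  have h := congrArg (fun p => (p.coeff k).coeff j) (sum_choose_mul_veroneseGen z w n)
  simpa only [Polynomial.finsetSum_coeff, Polynomial.coeff_natCast_mul, Polynomial.coeff_C_mul,
    Polynomial.coeff_map, Polynomial.coeff_mul_C, coeff_one_add_C_mul_X_pow,
    Polynomial.coeff_X_pow, if_neg hjk, mul_zero] using h

/-- The Veronese section in terms of the generating polynomial. -/
theorem veroneseSection_eq (n j : ℕ) (z : ℂ) (r : Fin (n + 1)) :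
    veroneseSection n j z r = ((j.factorial : ℂ) / (1 + (Complex.normSq z : ℂ)) ^ j) *
      (Real.sqrt (n.choose (r : ℕ)) : ℂ) *
      (veroneseGen z ((starRingEnd ℂ) z) r (n - r)).coeff j := by
  rw [coeff_veroneseGen, veroneseSection]

theorem conj_coeff_veroneseGen (z w : ℂ) (r m j : ℕ) :
    (starRingEnd ℂ) ((veroneseGen z w r m).coeff j) =
      (veroneseGen ((starRingEnd ℂ) z) ((starRingEnd ℂ) w) r m).coeff j := by
  simp [coeff_veroneseGen]

/-- For `n ≥ 1`, `0 ≤ j, k ≤ n` with `j ≠ k`, and `z ∈ ℂ`, the Veronese sections are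
pointwise orthogonal for the Hermitian inner product `⟨v,w⟩ = Σ_r v_r·conj(w_r)`:
`⟨V̂ⱼⁿ(z), V̂ₖⁿ(z)⟩ = 0`. -/
theorem veronese_sections_orthogonal (n j k : ℕ) (hn : 1 ≤ n) (hj : j ≤ n) (hk : k ≤ n)
    (hjk : j ≠ k) (z : ℂ) :
    ∑ r, veroneseSection n j z r * (starRingEnd ℂ) (veroneseSection n k z r) = 0 := by
  have key := sum_choose_mul_coeff_veroneseGen z ((starRingEnd ℂ) z) n hjk
  rw [← Fin.sum_univ_eq_sum_range (fun r => (n.choose r : ℂ) *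
    ((veroneseGen z ((starRingEnd ℂ) z) r (n - r)).coeff j *
      (veroneseGen ((starRingEnd ℂ) z) z r (n - r)).coeff k))] at key
  rw [← mul_zero (((j.factorial : ℂ) / (1 + (Complex.normSq z : ℂ)) ^ j) *
    ((k.factorial : ℂ) / (1 + (Complex.normSq z : ℂ)) ^ k)), ← key, Finset.mul_sum]
  refine Finset.sum_congr rfl fun r _ => ?_
  have hs : (Real.sqrt (n.choose (r : ℕ)) : ℂ) * (Real.sqrt (n.choose (r : ℕ)) : ℂ) =
      (n.choose (r : ℕ) : ℂ) := by
    rw [← Complex.ofReal_mul, Real.mul_self_sqrt (Nat.cast_nonneg _), Complex.ofReal_natCast]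
  simp only [veroneseSection_eq, map_mul, map_div₀, map_pow, map_add, map_one, map_natCast,
    Complex.conj_ofReal, conj_coeff_veroneseGen, Complex.conj_conj]
  rw [← hs]
  ring
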